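/- Let k ≥ 2 and 2 ≤ t+1 < r_1 ≤ … ≤ r_k, and for each i ∈ [k] let ℱ_i = 𝖯_{n_i,r_i}, where n_i ≥ (r_i − t − 1)·c(r_{k−1},r_k,t) + t + 1. Then (ℱ_1, …, ℱ_k) has the extrastrong cross-t-star property. -/

import Mathlib

open Finset

section Defs

variable {α : Type*} [DecidableEq α]

/-- `famStar F T` is ℱ(T) = {F ∈ ℱ : T ⊆ F}. -/
def famStar (F : Finset (Finset α)) (T : Finset α) : Finset (Finset α) :=
  F.filter (fun A => T ⊆ A)

/-- `lstar F t` is l(ℱ,t): the maximum of |ℱ(T)| over all t-element sets T. -/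
noncomputable def lstar (F : Finset (Finset α)) (t : ℕ) : ℕ :=
  sSup {n : ℕ | ∃ T : Finset α, T.card = t ∧ n = (famStar F T).card}

/-- c(r,s,t) = max{r·C(s,t), s·C(r,t)} + 1 if t ≤ min{r,s}, and 1 otherwise. -/
def cfun (r s t : ℕ) : ℕ :=
  if t ≤ min r s then max (r * Nat.choose s t) (s * Nat.choose r t) + 1 else 1

/-- The tuple (𝒜_1, …, 𝒜_k) is cross-t-intersecting. -/
def CrossTuple (t : ℕ) {k : ℕ} (A : Fin k → Finset (Finset α)) : Prop :=
  ∀ i j : Fin k, i ≠ j → ∀ a ∈ A i, ∀ b ∈ A j, t ≤ (a ∩ b).card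

/-- The cross-t-star property. -/
def CrossTStar (t : ℕ) {k : ℕ} (F : Fin k → Finset (Finset α)) : Prop :=
  ∀ A : Fin k → Finset (Finset α), CrossTuple t A → (∀ i, A i ⊆ F i) →
    ∏ i, (A i).card ≤ ∏ i, lstar (F i) t

/-- The strict cross-t-star property. -/
def StrictCrossTStar (t : ℕ) {k : ℕ} (F : Fin k → Finset (Finset α)) : Prop :=
  ∀ A : Fin k → Finset (Finset α), CrossTuple t A → (∀ i, A i ⊆ F i) →
    ∏ i, (A i).card ≤ ∏ i, lstar (F i) t ∧
      ((¬ ∃ T : Finset α, T.card = t ∧ ∀ i, A i = famStar (F i) T) →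
        ∏ i, (A i).card < ∏ i, lstar (F i) t)

/-- The strong cross-t-star property. -/
def StrongCrossTStar (t : ℕ) {k : ℕ} (F : Fin k → Finset (Finset α)) : Prop :=
  ∃ T : Finset α, T.card = t ∧
    ∀ A : Fin k → Finset (Finset α), CrossTuple t A → (∀ i, A i ⊆ F i) →
      ∏ i, (A i).card ≤ ∏ i, (famStar (F i) T).card

/-- The extrastrong cross-t-star property. -/
def ExtrastrongCrossTStar (t : ℕ) {k : ℕ} (F : Fin k → Finset (Finset α)) : Prop :=
  ∃ T : Finset α, T.card = t ∧
    ∀ A : Fin k → Finset (Finset α), CrossTuple t A → (∀ i, A i ⊆ F i) →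
      ∏ i, (A i).card ≤ ∏ i, (famStar (F i) T).card ∧
        (∏ i, (A i).card = ∏ i, (famStar (F i) T).card →
          ∃ T' : Finset α, T'.card = t ∧ ∀ i, A i = famStar (F i) T')

/-- 𝒮_{X,m}: the family of subsets of X × [m] that are graphs of functions
from X to [m]; 𝒮_{∅,m} = ∅. -/
def seqFam (X : Finset α) (m : ℕ) : Finset (Finset (α × ℕ)) :=
  (X ×ˢ Finset.Icc 1 m).powerset.filter
    (fun S => S.Nonempty ∧ S.image Prod.fst = X ∧ S.card = X.card)

/-- 𝒮_{ℱ,m} = ⋃_{F ∈ ℱ} 𝒮_{F,m}. -/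
def seqFamU (F : Finset (Finset α)) (m : ℕ) : Finset (Finset (α × ℕ)) :=
  F.biUnion (fun X => seqFam X m)

/-- 𝒮*_{X,m}: the family of subsets of X × [m] that are graphs of injective
functions from X to [m]; 𝒮*_{∅,m} = ∅. -/
def seqFamInj (X : Finset α) (m : ℕ) : Finset (Finset (α × ℕ)) :=
  (seqFam X m).filter (fun S => (S.image Prod.snd).card = S.card)

/-- 𝒮*_{ℱ,m} = ⋃_{F ∈ ℱ} 𝒮*_{F,m}. -/
def seqFamInjU (F : Finset (Finset α)) (m : ℕ) : Finset (Finset (α × ℕ)) :=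
  F.biUnion (fun X => seqFamInj X m)

end Defs

open Classical in
/-- ℳ_{n,r}: representations S_A of multisets A with members in [n] of total size r:
the r-element sets S of pairs (a,j) with a ∈ [n], 1 ≤ j, such that (a,j) ∈ S and
1 ≤ j' ≤ j imply (a,j') ∈ S. -/
noncomputable def multFam (n r : ℕ) : Finset (Finset (ℕ × ℕ)) :=
  (Finset.Icc 1 n ×ˢ Finset.Icc 1 r).powerset.filter
    (fun S => S.card = r ∧ ∀ p ∈ S, ∀ j ∈ Finset.Icc 1 p.2, (p.1, j) ∈ S)

/-- 𝒞_{n,r}: representations S_a = {(1,a_1),…,(r,a_r)} of compositions (a_1,…,a_r)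
of n of length r, i.e. graphs of functions from [r] to positive integers summing to n. -/
def compFam (n r : ℕ) : Finset (Finset (ℕ × ℕ)) :=
  (Finset.Icc 1 r ×ˢ Finset.Icc 1 n).powerset.filter
    (fun S => S.image Prod.fst = Finset.Icc 1 r ∧ S.card = r ∧ ∑ p ∈ S, p.2 = n)

/-- 𝖯_{n,r}: the family of partitions of [n] of length r, each partition viewed
as the set of its parts. -/
def partFam (n r : ℕ) : Finset (Finset (Finset ℕ)) :=
  (Finset.Icc 1 n).powerset.powerset.filter
    (fun P => P.card = r ∧ (∀ X ∈ P, X ≠ ∅) ∧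
      (∀ X ∈ P, ∀ Y ∈ P, X ≠ Y → X ∩ Y = ∅) ∧
      P.biUnion id = Finset.Icc 1 n)

/-- s_{n,r} = |𝖯_{n,r}|, the Stirling number of the second kind. -/
def stirling (n r : ℕ) : ℕ := (partFam n r).card

/-- The partitions of a finite set `X` into `q` non-empty parts. -/
def setPartitions (X : Finset ℕ) (q : ℕ) : Finset (Finset (Finset ℕ)) :=
  X.powerset.powerset.filter
    (fun P => P.card = q ∧ (∀ Y ∈ P, Y ≠ ∅) ∧
      (∀ Y ∈ P, ∀ Z ∈ P, Y ≠ Z → Y ∩ Z = ∅) ∧ P.biUnion id = X)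

theorem partFam_eq_setPartitions (n q : ℕ) :
    partFam n q = setPartitions (Finset.Icc 1 n) q := rfl

theorem mem_setPartitions {X : Finset ℕ} {q : ℕ} {P : Finset (Finset ℕ)} :
    P ∈ setPartitions X q ↔ P.card = q ∧ (∀ Y ∈ P, Y ≠ ∅) ∧
      (∀ Y ∈ P, ∀ Z ∈ P, Y ≠ Z → Y ∩ Z = ∅) ∧ P.biUnion id = X := by
  unfold setPartitions
  rw [Finset.mem_filter, and_iff_right_iff_imp]
  rintro ⟨-, -, -, h⟩
  rw [Finset.mem_powerset]
  intro Y hY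
  rw [Finset.mem_powerset, ← h]
  exact Finset.subset_biUnion_of_mem id hY

/-- Stirling numbers of the second kind, by the binomial recurrence. -/
def stirlingRec : ℕ → ℕ → ℕ
  | m, 0 => if m = 0 then 1 else 0
  | 0, _ + 1 => 0
  | m + 1, q + 1 => ∑ i ∈ Finset.range (m + 1), m.choose i * stirlingRec i q
termination_by _ q => q

theorem stirlingRec_zero_right (m : ℕ) : stirlingRec m 0 = if m = 0 then 1 else 0 := by
  rw [stirlingRec]

theorem stirlingRec_zero_succ (q : ℕ) : stirlingRec 0 (q + 1) = 0 := by
  rw [stirlingRec]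

theorem stirlingRec_succ_succ (m q : ℕ) :
    stirlingRec (m + 1) (q + 1) =
      ∑ i ∈ Finset.range (m + 1), m.choose i * stirlingRec i q := by
  rw [stirlingRec]

theorem stirlingRec_le_succ_succ (m q : ℕ) :
    stirlingRec m q ≤ stirlingRec (m + 1) (q + 1) := by
  rw [stirlingRec_succ_succ]
  have h := Finset.single_le_sum (f := fun i => m.choose i * stirlingRec i q)
    (fun i _ => Nat.zero_le _) (Finset.self_mem_range_succ m)
  simpa using h

theorem stirlingRec_mono_left (q : ℕ) : Monotone (fun m => stirlingRec m (q + 1)) := by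
  refine monotone_nat_of_le_succ fun m => ?_
  cases m with
  | zero => simp [stirlingRec_zero_succ]
  | succ m =>
    simp only [stirlingRec_succ_succ]
    refine (Finset.sum_le_sum fun i _ => ?_).trans
      (Finset.sum_le_sum_of_subset (Finset.range_mono (Nat.le_succ (m + 1))))
    exact Nat.mul_le_mul_right _ (Nat.choose_le_succ m i)

theorem stirlingRec_self_pos (q : ℕ) : 0 < stirlingRec q q := by
  induction q with
  | zero => simp [stirlingRec_zero_right]
  | succ q ih => exact ih.trans_le (stirlingRec_le_succ_succ q q)

theorem stirlingRec_pos {m q : ℕ} (hq : 1 ≤ q) (h : q ≤ m) : 0 < stirlingRec m q := by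
  obtain ⟨q, rfl⟩ := Nat.exists_eq_add_of_le' hq
  exact (stirlingRec_self_pos (q + 1)).trans_le (stirlingRec_mono_left q h)

theorem mul_stirlingRec_le (m q : ℕ) :
    m * stirlingRec m q ≤ q * stirlingRec (m + 1) (q + 1) := by
  induction q generalizing m with
  | zero =>
    rw [stirlingRec_zero_right]
    split_ifs with h <;> simp [h]
  | succ q ih =>
    cases m with
    | zero => simp
    | succ m =>
      rw [stirlingRec_succ_succ, stirlingRec_succ_succ, Finset.mul_sum, Finset.mul_sum,
        Finset.sum_range_succ' _ (m + 1)]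
      refine le_trans (Finset.sum_le_sum fun j _ => ?_) (Nat.le_add_right _ _)
      have h1 : (j + 1) * stirlingRec j q ≤ (q + 1) * stirlingRec (j + 1) (q + 1) := by
        linarith [ih j, stirlingRec_le_succ_succ j q]
      calc (m + 1) * (m.choose j * stirlingRec j q)
          = (m + 1) * m.choose j * stirlingRec j q := by ring
        _ = (m + 1).choose (j + 1) * ((j + 1) * stirlingRec j q) := by
          rw [Nat.add_one_mul_choose_eq]; ring
        _ ≤ (m + 1).choose (j + 1) * ((q + 1) * stirlingRec (j + 1) (q + 1)) :=
          Nat.mul_le_mul_left _ h1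
        _ = (q + 1) * ((m + 1).choose (j + 1) * stirlingRec (j + 1) (q + 1)) := by ring

theorem setPartitions_succ {X : Finset ℕ} {x : ℕ} (hx : x ∈ X) (q : ℕ) :
    setPartitions X (q + 1) =
      (X.erase x).powerset.biUnion
        (fun Y => (setPartitions Y q).image (fun Q => insert (X \ Y) Q)) := by
  ext P
  simp only [Finset.mem_biUnion, Finset.mem_powerset, Finset.mem_image]
  constructor
  · intro hP
    obtain ⟨hc, hne, hd, hU⟩ := mem_setPartitions.1 hP
    have hx' := hx
    rw [← hU, Finset.mem_biUnion] at hx'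
    obtain ⟨Z, hZ, hxZ⟩ := hx'
    have hZX : Z ⊆ X := hU ▸ Finset.subset_biUnion_of_mem id hZ
    refine ⟨X \ Z, ?_, P.erase Z, ?_, ?_⟩
    · intro y hy
      rw [Finset.mem_sdiff] at hy
      exact Finset.mem_erase.2 ⟨fun h => hy.2 (h ▸ hxZ), hy.1⟩
    · refine mem_setPartitions.2 ⟨?_, fun Y hY => hne Y (Finset.mem_of_mem_erase hY),
        fun Y hY W hW => hd Y (Finset.mem_of_mem_erase hY) W (Finset.mem_of_mem_erase hW), ?_⟩
      · rw [Finset.card_erase_of_mem hZ, hc]; rfl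
      · ext y
        simp only [Finset.mem_biUnion, Finset.mem_erase, id, Finset.mem_sdiff]
        constructor
        · rintro ⟨Y, ⟨hYZ, hY⟩, hy⟩
          refine ⟨hU ▸ Finset.mem_biUnion.2 ⟨Y, hY, hy⟩, fun hyZ => ?_⟩
          have := hd Y hY Z hZ hYZ
          exact absurd (Finset.mem_inter.2 ⟨hy, hyZ⟩) (by simp [this])
        · rintro ⟨hyX, hyZ⟩
          rw [← hU, Finset.mem_biUnion] at hyX
          obtain ⟨Y, hY, hy⟩ := hyX
          exact ⟨Y, ⟨fun h => hyZ (h ▸ hy), hY⟩, hy⟩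
    · rw [Finset.sdiff_sdiff_eq_self hZX, Finset.insert_erase hZ]
  · rintro ⟨Y, hY, Q, hQ, rfl⟩
    obtain ⟨hc, hne, hd, hU⟩ := mem_setPartitions.1 hQ
    have hxY : x ∉ Y := fun h => (Finset.mem_erase.1 (hY h)).1 rfl
    have hYX : Y ⊆ X := hY.trans (Finset.erase_subset _ _)
    have hsub : ∀ Z ∈ Q, Z ⊆ Y := fun Z hZ => hU ▸ Finset.subset_biUnion_of_mem id hZ
    have hdis : ∀ Z ∈ Q, (X \ Y) ∩ Z = ∅ := fun Z hZ => by
      ext y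
      simp only [Finset.mem_inter, Finset.mem_sdiff, Finset.notMem_empty, iff_false]
      exact fun h => h.1.2 (hsub Z hZ h.2)
    refine mem_setPartitions.2 ⟨?_, ?_, ?_, ?_⟩
    · rw [Finset.card_insert_of_notMem, hc]
      exact fun h => hxY (hsub _ h (Finset.mem_sdiff.2 ⟨hx, hxY⟩))
    · intro Z hZ
      rcases Finset.mem_insert.1 hZ with rfl | hZ
      · exact Finset.ne_empty_of_mem (Finset.mem_sdiff.2 ⟨hx, hxY⟩)
      · exact hne Z hZ
    · intro Z hZ W hW hZW
      rcases Finset.mem_insert.1 hZ with rfl | hZ <;> rcases Finset.mem_insert.1 hW with rfl | hW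
      · exact absurd rfl hZW
      · exact hdis W hW
      · rw [Finset.inter_comm]; exact hdis Z hZ
      · exact hd Z hZ W hW hZW
    · rw [Finset.biUnion_insert, hU, id, Finset.sdiff_union_of_subset hYX]

theorem card_setPartitions (X : Finset ℕ) (q : ℕ) :
    (setPartitions X q).card = stirlingRec X.card q := by
  induction q generalizing X with
  | zero =>
    rw [stirlingRec_zero_right]
    split_ifs with h
    · rw [Finset.card_eq_zero] at h
      subst h
      rw [Finset.card_eq_one]
      refine ⟨∅, ?_⟩
      ext P
      rw [mem_setPartitions, Finset.mem_singleton, Finset.card_eq_zero]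
      exact ⟨fun h => h.1, fun h => by subst h; simp⟩
    · rw [Finset.card_eq_zero] at h
      rw [Finset.card_eq_zero, Finset.eq_empty_iff_forall_notMem]
      intro P hP
      obtain ⟨hc, -, -, hU⟩ := mem_setPartitions.1 hP
      rw [Finset.card_eq_zero] at hc
      subst hc
      exact h (by simpa using hU.symm)
  | succ q ih =>
    rcases X.eq_empty_or_nonempty with rfl | ⟨x, hx⟩
    · rw [Finset.card_empty, stirlingRec_zero_succ, Finset.card_eq_zero,
        Finset.eq_empty_iff_forall_notMem]
      intro P hP
      obtain ⟨hc, hne, -, hU⟩ := mem_setPartitions.1 hP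
      obtain ⟨Z, hZ⟩ := Finset.card_pos.1 (by rw [hc]; exact Nat.succ_pos q)
      have hs := Finset.subset_biUnion_of_mem id hZ
      rw [hU] at hs
      exact hne Z hZ (Finset.subset_empty.1 hs)
    · rw [setPartitions_succ hx, Finset.card_biUnion]
      · have himg : ∀ Y ∈ (X.erase x).powerset,
            ((setPartitions Y q).image (fun Q => insert (X \ Y) Q)).card =
              stirlingRec Y.card q := by
          intro Y hY
          rw [← ih Y]
          refine Finset.card_image_of_injOn fun Q hQ Q' hQ' h => ?_
          have hxY : x ∉ Y := fun h => (Finset.mem_erase.1 (Finset.mem_powerset.1 hY h)).1 rfl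
          have hnot : ∀ R ∈ setPartitions Y q, X \ Y ∉ R := fun R hR hm => by
            have hs := Finset.subset_biUnion_of_mem id hm
            rw [(mem_setPartitions.1 hR).2.2.2] at hs
            exact hxY (hs (Finset.mem_sdiff.2 ⟨hx, hxY⟩))
          have h' := congrArg (fun R => Finset.erase R (X \ Y)) h
          simpa [Finset.erase_insert (hnot Q hQ), Finset.erase_insert (hnot Q' hQ')] using h'
        rw [Finset.sum_congr rfl himg, Finset.sum_powerset_apply_card
          (fun i => stirlingRec i q), ← Finset.card_erase_add_one hx, stirlingRec_succ_succ]
        simp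
      · intro Y hY Y' hY' hne
        rw [Function.onFun, Finset.disjoint_left]
        intro P hP hP'
        obtain ⟨Q, hQ, rfl⟩ := Finset.mem_image.1 hP
        obtain ⟨Q', hQ', h⟩ := Finset.mem_image.1 hP'
        rw [Finset.mem_coe, Finset.mem_powerset] at hY hY'
        have hxY : x ∉ Y := fun h => (Finset.mem_erase.1 (hY h)).1 rfl
        have hxY' : x ∉ Y' := fun h => (Finset.mem_erase.1 (hY' h)).1 rfl
        have hm : X \ Y ∈ insert (X \ Y') Q' := h ▸ Finset.mem_insert_self _ _
        rcases Finset.mem_insert.1 hm with he | hm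
        · apply hne
          rw [← Finset.sdiff_sdiff_eq_self (hY.trans (Finset.erase_subset _ _)), he,
            Finset.sdiff_sdiff_eq_self (hY'.trans (Finset.erase_subset _ _))]
        · have hs : X \ Y ⊆ Y' :=
            (mem_setPartitions.1 hQ').2.2.2 ▸ Finset.subset_biUnion_of_mem id hm
          exact hxY' (hs (Finset.mem_sdiff.2 ⟨hx, hxY⟩))

theorem card_famStar_partFam_le (n : ℕ) {q : ℕ} {T : Finset (Finset ℕ)} (hT : T.card < q) :
    (famStar (partFam n q) T).card ≤ stirlingRec (n - T.card) (q - T.card) := by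
  rcases (famStar (partFam n q) T).eq_empty_or_nonempty with he | ⟨P₀, hP₀⟩
  · simp [he]
  have hmem : ∀ {P}, P ∈ famStar (partFam n q) T ↔
      P ∈ setPartitions (Finset.Icc 1 n) q ∧ T ⊆ P := by
    intro P; rw [famStar, Finset.mem_filter]; rfl
  obtain ⟨hP, hTP⟩ := hmem.1 hP₀
  obtain ⟨-, hne₀, hd₀, hU₀⟩ := mem_setPartitions.1 hP
  set U := T.biUnion id with hUdef
  have hTU : T.card ≤ U.card := by
    refine Finset.card_le_card_biUnion ?_ ?_
    · intro Y hY Z hZ hYZ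
      exact Finset.disjoint_iff_inter_eq_empty.2 (hd₀ Y (hTP hY) Z (hTP hZ) hYZ)
    · intro Y hY
      exact Finset.nonempty_iff_ne_empty.2 (hne₀ Y (hTP hY))
  have hUn : U ⊆ Finset.Icc 1 n := hU₀ ▸ Finset.biUnion_subset_biUnion_of_subset_left id hTP
  have hle : (famStar (partFam n q) T).card ≤
      (setPartitions (Finset.Icc 1 n \ U) (q - T.card)).card := by
    refine Finset.card_le_card_of_injOn (fun P => P \ T) ?_ ?_
    · intro P hP
      obtain ⟨hP, hTP⟩ := hmem.1 hP
      obtain ⟨hc, hne, hd, hU⟩ := mem_setPartitions.1 hP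
      refine mem_setPartitions.2 ⟨?_, ?_, ?_, ?_⟩
      · rw [Finset.card_sdiff_of_subset hTP, hc]
      · exact fun Y hY => hne Y (Finset.mem_sdiff.1 hY).1
      · exact fun Y hY Z hZ => hd Y (Finset.mem_sdiff.1 hY).1 Z (Finset.mem_sdiff.1 hZ).1
      · ext y
        rw [← hU]
        simp only [hUdef, Finset.mem_biUnion, Finset.mem_sdiff, id, not_exists, not_and]
        constructor
        · rintro ⟨Y, ⟨hY, hYT⟩, hy⟩
          refine ⟨⟨Y, hY, hy⟩, fun Z hZ hyZ => ?_⟩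
          have := hd Y hY Z (hTP hZ) (fun h => hYT (h ▸ hZ))
          exact absurd (Finset.mem_inter.2 ⟨hy, hyZ⟩) (by simp [this])
        · rintro ⟨⟨Y, hY, hy⟩, h⟩
          exact ⟨Y, ⟨hY, fun hYT => h Y hYT hy⟩, hy⟩
    · intro P hP P' hP' h
      rw [← Finset.sdiff_union_of_subset (hmem.1 hP).2,
        ← Finset.sdiff_union_of_subset (hmem.1 hP').2]
      exact congrArg (· ∪ T) h
  refine hle.trans ?_
  rw [card_setPartitions, Finset.card_sdiff_of_subset hUn, Nat.card_Icc, Nat.add_sub_cancel]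
  obtain ⟨p, hp⟩ := Nat.exists_eq_add_of_lt hT
  have hq : q - T.card = p + 1 := by omega
  rw [hq]
  exact stirlingRec_mono_left p (Nat.sub_le_sub_left hTU n)

/-- The `t` singletons `{1}, …, {t}`. -/
def singletonsUpTo (t : ℕ) : Finset (Finset ℕ) :=
  (Finset.Icc 1 t).image (fun x => {x})

theorem card_singletonsUpTo (t : ℕ) : (singletonsUpTo t).card = t := by
  rw [singletonsUpTo, Finset.card_image_of_injective _ Finset.singleton_injective]
  simp

theorem biUnion_singletonsUpTo (t : ℕ) : (singletonsUpTo t).biUnion id = Finset.Icc 1 t := by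
  ext y
  simp [singletonsUpTo]

theorem card_famStar_singletonsUpTo {n q t : ℕ} (htn : t ≤ n) (htq : t < q) :
    (famStar (partFam n q) (singletonsUpTo t)).card = stirlingRec (n - t) (q - t) := by
  refine le_antisymm ?_ ?_
  · have h := card_famStar_partFam_le n (T := singletonsUpTo t) (q := q)
    rw [card_singletonsUpTo] at h
    exact h htq
  have hsub : Finset.Icc 1 t ⊆ Finset.Icc 1 n := Finset.Icc_subset_Icc_right htn
  have hcard : stirlingRec (n - t) (q - t) =
      (setPartitions (Finset.Icc 1 n \ Finset.Icc 1 t) (q - t)).card := by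
    rw [card_setPartitions, Finset.card_sdiff_of_subset hsub]
    simp
  have hdis : ∀ Q ∈ setPartitions (Finset.Icc 1 n \ Finset.Icc 1 t) (q - t),
      ∀ Y ∈ singletonsUpTo t, ∀ Z ∈ Q, Y ∩ Z = ∅ := by
    intro Q hQ Y hY Z hZ
    have hZs := Finset.subset_biUnion_of_mem id hZ
    rw [(mem_setPartitions.1 hQ).2.2.2] at hZs
    have hYs := Finset.subset_biUnion_of_mem id hY
    rw [biUnion_singletonsUpTo] at hYs
    rw [← Finset.disjoint_iff_inter_eq_empty]
    exact Finset.disjoint_of_subset_left hYs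
      (Finset.disjoint_of_subset_right hZs Finset.disjoint_sdiff)
  have hdisj : ∀ Q ∈ setPartitions (Finset.Icc 1 n \ Finset.Icc 1 t) (q - t),
      Disjoint Q (singletonsUpTo t) := by
    intro Q hQ
    rw [Finset.disjoint_left]
    intro Z hZ hZ'
    have h := hdis Q hQ Z hZ' Z hZ
    rw [Finset.inter_self] at h
    exact (mem_setPartitions.1 hQ).2.1 Z hZ h
  rw [hcard]
  refine Finset.card_le_card_of_injOn (fun Q => Q ∪ singletonsUpTo t) ?_ ?_
  · intro Q hQ
    obtain ⟨hc, hne, hd, hU⟩ := mem_setPartitions.1 hQ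
    refine Finset.mem_filter.2 ⟨?_, Finset.subset_union_right⟩
    rw [partFam_eq_setPartitions]
    refine mem_setPartitions.2 ⟨?_, ?_, ?_, ?_⟩
    · rw [Finset.card_union_of_disjoint (hdisj Q hQ), hc, card_singletonsUpTo]
      omega
    · intro Y hY
      rcases Finset.mem_union.1 hY with hY | hY
      · exact hne Y hY
      · obtain ⟨y, -, rfl⟩ := Finset.mem_image.1 hY
        exact Finset.singleton_ne_empty y
    · intro Y hY Z hZ hYZ
      rcases Finset.mem_union.1 hY with hY | hY <;> rcases Finset.mem_union.1 hZ with hZ | hZ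
      · exact hd Y hY Z hZ hYZ
      · rw [Finset.inter_comm]; exact hdis Q hQ Z hZ Y hY
      · exact hdis Q hQ Y hY Z hZ
      · obtain ⟨y, -, rfl⟩ := Finset.mem_image.1 hY
        obtain ⟨z, -, rfl⟩ := Finset.mem_image.1 hZ
        rw [← Finset.disjoint_iff_inter_eq_empty, Finset.disjoint_singleton]
        exact fun h => hYZ (h ▸ rfl)
    · rw [Finset.union_biUnion, hU, biUnion_singletonsUpTo, Finset.sdiff_union_of_subset hsub]
  · intro Q hQ Q' hQ' h
    have h' := congrArg (· \ singletonsUpTo t) h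
    simpa [Finset.union_sdiff_cancel_right (hdisj Q hQ),
      Finset.union_sdiff_cancel_right (hdisj Q' hQ')] using h'

section CrossIntersecting

variable {α : Type*} [DecidableEq α]

theorem mem_famStar {F : Finset (Finset α)} {T a : Finset α} :
    a ∈ famStar F T ↔ a ∈ F ∧ T ⊆ a := Finset.mem_filter

theorem card_le_choose_mul {A : Finset (Finset α)} {b : Finset α} {t L : ℕ}
    (hA : ∀ a ∈ A, t ≤ (a ∩ b).card)
    (hL : ∀ T : Finset α, T.card = t → (famStar A T).card ≤ L) :
    A.card ≤ b.card.choose t * L := by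
  have hsub : A ⊆ (b.powersetCard t).biUnion (fun T => famStar A T) := by
    intro a ha
    obtain ⟨T, hT, hc⟩ := Finset.exists_subset_card_eq (hA a ha)
    exact Finset.mem_biUnion.2 ⟨T, Finset.mem_powersetCard.2
      ⟨hT.trans Finset.inter_subset_right, hc⟩,
      mem_famStar.2 ⟨ha, hT.trans Finset.inter_subset_left⟩⟩
  refine (Finset.card_le_card hsub).trans ?_
  rw [← Finset.card_powersetCard t b]
  exact Finset.card_biUnion_le_card_mul _ _ _
    (fun T hT => hL T (Finset.mem_powersetCard.1 hT).2)

theorem mul_card_famStar_le {A : Finset (Finset α)} {b T : Finset α} {t c L : ℕ}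
    (hA : ∀ a ∈ A, t ≤ (a ∩ b).card) (hT : T.card = t) (hTb : ¬ T ⊆ b)
    (hL : ∀ T : Finset α, T.card = t + 1 → c * (famStar A T).card ≤ L) :
    c * (famStar A T).card ≤ b.card * L := by
  have hsub : famStar A T ⊆ (b \ T).biUnion (fun x => famStar A (insert x T)) := by
    intro a ha
    obtain ⟨haA, hTa⟩ := mem_famStar.1 ha
    have hex : ¬ a ∩ b ⊆ T := by
      intro h
      have he : a ∩ b = T := Finset.eq_of_subset_of_card_le h (hT ▸ hA a haA)
      exact hTb (he ▸ Finset.inter_subset_right)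
    obtain ⟨x, hx, hxT⟩ := Finset.not_subset.1 hex
    rw [Finset.mem_inter] at hx
    exact Finset.mem_biUnion.2 ⟨x, Finset.mem_sdiff.2 ⟨hx.2, hxT⟩,
      mem_famStar.2 ⟨haA, Finset.insert_subset hx.1 hTa⟩⟩
  calc c * (famStar A T).card
      ≤ c * ∑ x ∈ b \ T, (famStar A (insert x T)).card :=
        Nat.mul_le_mul_left _ ((Finset.card_le_card hsub).trans Finset.card_biUnion_le)
    _ = ∑ x ∈ b \ T, c * (famStar A (insert x T)).card := Finset.mul_sum _ _ _
    _ ≤ ∑ _x ∈ b \ T, L := Finset.sum_le_sum fun x hx => hL _ (by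
        rw [Finset.card_insert_of_notMem (Finset.mem_sdiff.1 hx).2, hT])
    _ = (b \ T).card * L := by rw [Finset.sum_const, smul_eq_mul]
    _ ≤ b.card * L := Nat.mul_le_mul_right _ (Finset.card_le_card Finset.sdiff_subset)

theorem mul_card_le_choose_mul {A B : Finset (Finset α)} {t c s L : ℕ}
    (hAB : ∀ a ∈ A, ∀ b ∈ B, t ≤ (a ∩ b).card) (hs : ∀ b ∈ B, b.card = s) (hB : B.Nonempty)
    (hL : ∀ T : Finset α, T.card = t + 1 → c * (famStar A T).card ≤ L)
    (hno : ∀ T : Finset α, T.card = t → ∃ b ∈ B, ¬ T ⊆ b) :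
    c * A.card ≤ s.choose t * (s * L) := by
  obtain ⟨b₀, hb₀⟩ := hB
  rcases Nat.eq_zero_or_pos c with rfl | hc
  · simp
  have h := card_le_choose_mul (A := A) (b := b₀) (t := t) (L := s * L / c)
    (fun a ha => hAB a ha b₀ hb₀) (fun T hT => by
      obtain ⟨b, hb, hTb⟩ := hno T hT
      rw [Nat.le_div_iff_mul_le hc, mul_comm, ← hs b hb]
      exact mul_card_famStar_le (fun a ha => hAB a ha b hb) hT hTb hL)
  rw [hs b₀ hb₀] at h
  calc c * A.card ≤ c * (s.choose t * (s * L / c)) := Nat.mul_le_mul_left _ h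
    _ = s.choose t * (c * (s * L / c)) := by ring
    _ ≤ s.choose t * (s * L) := Nat.mul_le_mul_left _ (Nat.mul_div_le _ _)

theorem card_mul_card_lt_of_subset_famStar {A B : Finset (Finset α)} {t c r s L M : ℕ}
    (hAB : ∀ a ∈ A, ∀ b ∈ B, t ≤ (a ∩ b).card) (hr : ∀ a ∈ A, a.card = r)
    (hs : ∀ b ∈ B, b.card = s) (hA : A.Nonempty)
    (hL : ∀ T : Finset α, T.card = t + 1 → c * (famStar A T).card ≤ L)
    (hM : ∀ T : Finset α, T.card = t → (famStar B T).card ≤ M)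
    (hL0 : 0 < L) (hM0 : 0 < M) (hc : s * r.choose t < c)
    {T : Finset α} (hT : T.card = t) (hTA : ∀ a ∈ A, T ⊆ a) {b : Finset α} (hb : b ∈ B)
    (hTb : ¬ T ⊆ b) : A.card * B.card < L * M := by
  obtain ⟨a₀, ha₀⟩ := hA
  have h1 := mul_card_famStar_le (fun a ha => hAB a ha b hb) hT hTb hL
  have h2 := card_le_choose_mul (A := B) (b := a₀)
    (fun b hb => Finset.inter_comm a₀ b ▸ hAB a₀ ha₀ b hb) hM
  rw [famStar, Finset.filter_true_of_mem hTA, hs b hb] at h1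
  rw [hr a₀ ha₀] at h2
  refine lt_of_mul_lt_mul_left (a := c) ?_ (Nat.zero_le c)
  calc c * (A.card * B.card) = c * A.card * B.card := by ring
    _ ≤ s * L * (r.choose t * M) := Nat.mul_le_mul h1 h2
    _ = s * r.choose t * (L * M) := by ring
    _ < c * (L * M) := Nat.mul_lt_mul_of_pos_right hc (Nat.mul_pos hL0 hM0)

theorem card_mul_card_lt_or_exists_common {A B : Finset (Finset α)} {t c r s L M : ℕ}
    (hAB : ∀ a ∈ A, ∀ b ∈ B, t ≤ (a ∩ b).card) (hr : ∀ a ∈ A, a.card = r)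
    (hs : ∀ b ∈ B, b.card = s) (hA : A.Nonempty) (hB : B.Nonempty)
    (hL : ∀ T : Finset α, T.card = t → (famStar A T).card ≤ L)
    (hL' : ∀ T : Finset α, T.card = t + 1 → c * (famStar A T).card ≤ L)
    (hM : ∀ T : Finset α, T.card = t → (famStar B T).card ≤ M)
    (hM' : ∀ T : Finset α, T.card = t + 1 → c * (famStar B T).card ≤ M)
    (hL0 : 0 < L) (hM0 : 0 < M) (hc : s * r.choose t < c) (hc' : r * s.choose t < c) :
    A.card * B.card < L * M ∨
      ∃ T : Finset α, T.card = t ∧ (∀ a ∈ A, T ⊆ a) ∧ ∀ b ∈ B, T ⊆ b := by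
  have hBA : ∀ b ∈ B, ∀ a ∈ A, t ≤ (b ∩ a).card :=
    fun b hb a ha => Finset.inter_comm a b ▸ hAB a ha b hb
  by_cases h1 : ∃ T : Finset α, T.card = t ∧ ∀ a ∈ A, T ⊆ a
  · obtain ⟨T, hT, hTA⟩ := h1
    by_cases hTB : ∀ b ∈ B, T ⊆ b
    · exact Or.inr ⟨T, hT, hTA, hTB⟩
    · push Not at hTB
      obtain ⟨b, hb, hTb⟩ := hTB
      exact Or.inl (card_mul_card_lt_of_subset_famStar hAB hr hs hA hL' hM hL0 hM0 hc hT hTA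
        hb hTb)
  · by_cases h2 : ∃ T : Finset α, T.card = t ∧ ∀ b ∈ B, T ⊆ b
    · obtain ⟨T, hT, hTB⟩ := h2
      by_cases hTA : ∀ a ∈ A, T ⊆ a
      · exact Or.inr ⟨T, hT, hTA, hTB⟩
      · push Not at hTA
        obtain ⟨a, ha, hTa⟩ := hTA
        left
        rw [mul_comm A.card, mul_comm L]
        exact card_mul_card_lt_of_subset_famStar hBA hs hr hB hM' hL hM0 hL0 hc' hT hTB ha hTa
    · push Not at h1 h2
      left
      have hA' := mul_card_le_choose_mul hAB hs hB hL' h2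
      have hB' := mul_card_le_choose_mul hBA hr hA hM' h1
      refine lt_of_mul_lt_mul_left (a := c * c) ?_ (Nat.zero_le _)
      calc c * c * (A.card * B.card) = c * A.card * (c * B.card) := by ring
        _ ≤ s.choose t * (s * L) * (r.choose t * (r * M)) := Nat.mul_le_mul hA' hB'
        _ = s * r.choose t * (r * s.choose t) * (L * M) := by ring
        _ < c * c * (L * M) :=
          Nat.mul_lt_mul_of_pos_right (Nat.mul_lt_mul'' hc hc') (Nat.mul_pos hL0 hM0)

end CrossIntersecting

theorem prod_lt_prod_or_forall_le {ι : Type*} [Fintype ι] [DecidableEq ι] [Nontrivial ι]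
    {a L : ι → ℕ} (hL : ∀ i, 0 < L i)
    (h : ∀ i j, i ≠ j → a i * a j < L i * L j ∨ (a i ≤ L i ∧ a j ≤ L j)) :
    ∏ i, a i < ∏ i, L i ∨ ∀ i, a i ≤ L i := by
  by_contra! hcon
  obtain ⟨hle, i, hi⟩ := hcon
  obtain ⟨j, hj⟩ := exists_ne i
  have hlt : ∀ l, l ≠ i → a i * a l < L i * L l := fun l hl =>
    (h i l hl.symm).resolve_right fun h' => absurd h'.1 (not_le.2 hi)
  have hothers : ∀ l, l ≠ i → a l ≤ L l := by
    intro l hl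
    by_contra! hc
    exact absurd (hlt l hl) (not_lt.2 (Nat.mul_le_mul hi.le hc.le))
  have hsplit : ∀ f : ι → ℕ, ∏ l, f l = f i * f j * ∏ l ∈ (Finset.univ.erase i).erase j, f l := by
    intro f
    rw [mul_assoc, Finset.mul_prod_erase _ f (Finset.mem_erase.2 ⟨hj, Finset.mem_univ j⟩),
      Finset.mul_prod_erase _ f (Finset.mem_univ i)]
  rw [hsplit a, hsplit L] at hle
  refine absurd hle (not_le.2 ?_)
  calc a i * a j * ∏ l ∈ (Finset.univ.erase i).erase j, a l
      ≤ a i * a j * ∏ l ∈ (Finset.univ.erase i).erase j, L l :=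
        Nat.mul_le_mul_left _ (Finset.prod_le_prod' fun l hl =>
          hothers l (Finset.mem_erase.1 (Finset.mem_erase.1 hl).2).1)
    _ < L i * L j * ∏ l ∈ (Finset.univ.erase i).erase j, L l :=
        Nat.mul_lt_mul_of_pos_right (hlt j hj) (Finset.prod_pos fun l _ => hL l)

theorem mul_choose_lt_cfun {r s r' s' t : ℕ} (hr : r ≤ r') (hs : s ≤ s') (htr : t ≤ r)
    (hts : t ≤ s) : r * s.choose t < cfun r' s' t ∧ s * r.choose t < cfun r' s' t := by
  rw [cfun, if_pos (le_min (htr.trans hr) (hts.trans hs))]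
  constructor
  · exact Nat.lt_succ_of_le ((Nat.mul_le_mul hr (Nat.choose_le_choose t hs)).trans
      (le_max_left _ _))
  · exact Nat.lt_succ_of_le ((Nat.mul_le_mul hs (Nat.choose_le_choose t hr)).trans
      (le_max_right _ _))

theorem mul_stirlingRec_sub_le {n q t c : ℕ} (htq : t + 1 < q)
    (hn : (q - t - 1) * c + t + 1 ≤ n) :
    c * stirlingRec (n - (t + 1)) (q - (t + 1)) ≤ stirlingRec (n - t) (q - t) := by
  have h := mul_stirlingRec_le (n - (t + 1)) (q - (t + 1))
  have e1 : n - (t + 1) + 1 = n - t := by omega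
  have e2 : q - (t + 1) + 1 = q - t := by omega
  rw [e1, e2] at h
  have hle : (q - (t + 1)) * c ≤ n - (t + 1) := by
    rw [Nat.sub_sub] at hn
    omega
  refine le_of_mul_le_mul_left (a := q - (t + 1)) ?_ (by omega)
  calc (q - (t + 1)) * (c * stirlingRec (n - (t + 1)) (q - (t + 1)))
      = (q - (t + 1)) * c * stirlingRec (n - (t + 1)) (q - (t + 1)) := by ring
    _ ≤ _ := (Nat.mul_le_mul_right _ hle).trans h

/-- Theorem 4.12 (families of set partitions). -/
theorem stmt_19 {k : ℕ} (hk : 2 ≤ k) (t : ℕ) (ht : 1 ≤ t)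
    (r n : Fin k → ℕ) (hmono : Monotone r) (htr : t + 1 < r ⟨0, by omega⟩)
    (hn : ∀ i, (r i - t - 1) * cfun (r ⟨k - 2, by omega⟩) (r ⟨k - 1, by omega⟩) t + t + 1
      ≤ n i) :
    ExtrastrongCrossTStar t (fun i => partFam (n i) (r i)) := by
  have hr : ∀ i, t + 1 < r i := fun i => htr.trans_le (hmono (Nat.zero_le _))
  set c := cfun (r ⟨k - 2, by omega⟩) (r ⟨k - 1, by omega⟩) t with hcdef
  have hlt : ∀ i j : Fin k, i < j →
      r i * (r j).choose t < c ∧ r j * (r i).choose t < c := fun i j hij =>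
    mul_choose_lt_cfun
      (hmono (by rw [Fin.le_def]; rw [Fin.lt_def] at hij; simp only; omega))
      (hmono (by rw [Fin.le_def]; simp only; omega))
      (by have := hr i; omega) (by have := hr j; omega)
  have hpair : ∀ i j : Fin k, i ≠ j → r i * (r j).choose t < c := fun i j hij =>
    (lt_or_gt_of_ne hij).elim (fun h => (hlt i j h).1) (fun h => (hlt j i h).2)
  have hc1 : 1 < c := by
    have h := hpair ⟨0, by omega⟩ ⟨1, by omega⟩ (by simp)
    have h0 := hr ⟨0, by omega⟩
    have h1 := Nat.choose_pos (show t ≤ r ⟨1, by omega⟩ by have := hr ⟨1, by omega⟩; omega)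
    nlinarith
  have hnr : ∀ i, r i ≤ n i := by
    intro i
    have h1 := hn i
    have h2 := hr i
    have h3 : r i - t - 1 ≤ (r i - t - 1) * c := Nat.le_mul_of_pos_right _ (by omega)
    omega
  set L : Fin k → ℕ := fun i => stirlingRec (n i - t) (r i - t) with hLdef
  have hL0 : ∀ i, 0 < L i := fun i =>
    stirlingRec_pos (by have := hr i; omega) (by have := hnr i; omega)
  have hstar : ∀ i (T : Finset (Finset ℕ)), T.card = t →
      (famStar (partFam (n i) (r i)) T).card ≤ L i := by
    intro i T hT
    have h := card_famStar_partFam_le (n i) (T := T) (q := r i) (by have := hr i; omega)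
    rwa [hT] at h
  have hstar' : ∀ i (T : Finset (Finset ℕ)), T.card = t + 1 →
      c * (famStar (partFam (n i) (r i)) T).card ≤ L i := by
    intro i T hT
    have h := card_famStar_partFam_le (n i) (T := T) (q := r i) (by have := hr i; omega)
    rw [hT] at h
    exact (Nat.mul_le_mul_left c h).trans (mul_stirlingRec_sub_le (hr i) (hn i))
  have : Nontrivial (Fin k) := Fin.nontrivial_iff_two_le.2 hk
  refine ⟨singletonsUpTo t, card_singletonsUpTo t, fun A hcross hsub => ?_⟩
  have hprod : ∏ i, (famStar (partFam (n i) (r i)) (singletonsUpTo t)).card = ∏ i, L i :=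
    Finset.prod_congr rfl fun i _ => card_famStar_singletonsUpTo
      (by have := hr i; have := hnr i; omega) (by have := hr i; omega)
  simp only [hprod]
  by_cases hne : ∀ i, (A i).Nonempty
  swap
  · push Not at hne
    obtain ⟨i, hi⟩ := hne
    have h0 : ∏ i, (A i).card = 0 := Finset.prod_eq_zero (Finset.mem_univ i) (by simp [hi])
    have hpos : 0 < ∏ i, L i := Finset.prod_pos fun i _ => hL0 i
    rw [h0]
    exact ⟨hpos.le, fun h => absurd h hpos.ne⟩
  have hmonoStar : ∀ i (T : Finset (Finset ℕ)),
      (famStar (A i) T).card ≤ (famStar (partFam (n i) (r i)) T).card := fun i T =>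
    Finset.card_le_card (Finset.filter_subset_filter _ (hsub i))
  have hcards : ∀ i, ∀ a ∈ A i, a.card = r i := fun i a ha =>
    (mem_setPartitions.1 (hsub i ha)).1
  have hdich : ∀ i j, i ≠ j → (A i).card * (A j).card < L i * L j ∨
      ∃ T : Finset (Finset ℕ), T.card = t ∧ (∀ a ∈ A i, T ⊆ a) ∧ ∀ b ∈ A j, T ⊆ b :=
    fun i j hij => card_mul_card_lt_or_exists_common (hcross i j hij) (hcards i) (hcards j)
      (hne i) (hne j) (fun T hT => (hmonoStar i T).trans (hstar i T hT))
      (fun T hT => (Nat.mul_le_mul_left c (hmonoStar i T)).trans (hstar' i T hT))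
      (fun T hT => (hmonoStar j T).trans (hstar j T hT))
      (fun T hT => (Nat.mul_le_mul_left c (hmonoStar j T)).trans (hstar' j T hT))
      (hL0 i) (hL0 j) (hpair j i hij.symm) (hpair i j hij)
  have hsubStar : ∀ i (T : Finset (Finset ℕ)), (∀ a ∈ A i, T ⊆ a) →
      A i ⊆ famStar (partFam (n i) (r i)) T := fun i T h a ha =>
    mem_famStar.2 ⟨hsub i ha, h a ha⟩
  have hleL : ∀ i (T : Finset (Finset ℕ)), T.card = t → (∀ a ∈ A i, T ⊆ a) →
      (A i).card ≤ L i := fun i T hT h =>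
    (Finset.card_le_card (hsubStar i T h)).trans (hstar i T hT)
  rcases prod_lt_prod_or_forall_le hL0 (a := fun i => (A i).card) (fun i j hij =>
    (hdich i j hij).imp_right fun ⟨T, hT, hi, hj⟩ => ⟨hleL i T hT hi, hleL j T hT hj⟩)
    with hlt | hle
  · exact ⟨hlt.le, fun h => absurd h hlt.ne⟩
  refine ⟨Finset.prod_le_prod' fun i _ => hle i, fun heq => ?_⟩
  have hall : ∀ i, (A i).card = L i := by
    by_contra! hex
    obtain ⟨i, hi⟩ := hex
    exact absurd heq (Finset.prod_lt_prod (fun j _ => Finset.card_pos.2 (hne j))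
      (fun j _ => hle j) ⟨i, Finset.mem_univ i, lt_of_le_of_ne (hle i) hi⟩).ne
  have hcommon : ∀ i j, i ≠ j →
      ∃ T : Finset (Finset ℕ), T.card = t ∧ (∀ a ∈ A i, T ⊆ a) ∧ ∀ b ∈ A j, T ⊆ b := by
    intro i j hij
    refine (hdich i j hij).resolve_left ?_
    rw [hall i, hall j]
    exact lt_irrefl _
  have hunique : ∀ i (T T' : Finset (Finset ℕ)), T.card = t → T'.card = t →
      (∀ a ∈ A i, T ⊆ a) → (∀ a ∈ A i, T' ⊆ a) → T = T' := by
    intro i T T' hT hT' h h'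
    by_contra hTT
    have hnot : ¬ T' ⊆ T := fun hs =>
      hTT (Finset.eq_of_subset_of_card_le hs (by omega)).symm
    obtain ⟨x, hx, hxT⟩ := Finset.not_subset.1 hnot
    have hle := Finset.card_le_card (hsubStar i (insert x T)
      fun a ha => Finset.insert_subset (h' a ha hx) (h a ha))
    have hc := hstar' i (insert x T) (by rw [Finset.card_insert_of_notMem hxT, hT])
    rw [hall i] at hle
    have := hL0 i
    nlinarith
  have heqStar : ∀ i (T : Finset (Finset ℕ)), T.card = t → (∀ a ∈ A i, T ⊆ a) →
      A i = famStar (partFam (n i) (r i)) T := fun i T hT h =>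
    Finset.eq_of_subset_of_card_le (hsubStar i T h) ((hall i).symm ▸ hstar i T hT)
  let i₀ : Fin k := ⟨0, by omega⟩
  obtain ⟨j₀, hj₀⟩ := exists_ne i₀
  obtain ⟨T, hT, hTi, -⟩ := hcommon i₀ j₀ hj₀.symm
  refine ⟨T, hT, fun i => heqStar i T hT ?_⟩
  by_cases hi : i = i₀
  · exact hi ▸ hTi
  · obtain ⟨T', hT', hT'i, hT'i₀⟩ := hcommon i i₀ hi
    rwa [hunique i₀ T T' hT hT' hTi hT'i₀]
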